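/- arXiv:0802.3896 — 2 statements merged into one kernel-verified Lean document; each statement's English description precedes it below -/
import Mathlib

section
/- Assume R1 ≠ R2, ‖R1‖ ≤ 1, ‖R2‖ ≤ 1, that the target Bloch vectors are anti-parallel, i.e. Rb1·Rb2 = −‖Rb1‖·‖Rb2‖, and that T ≤ 0. Then Rx²·(‖Rb1‖ − ‖Rb2‖)² ≤ Rm²·((‖Rb1‖ − ‖Rb2‖)² − T). (This shows that sin ϑ = Rx·(‖Rb1‖ − ‖Rb2‖)/(Rm·√(Rbp² − T)) is a valid sine, i.e. lies in [−1, 1], in procedure B with anti-parallel targets.) -/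
noncomputable section

open Real

/-- Euclidean dot product on ℝ³ (vectors as `Fin 3 → ℝ`). -/
def dot3 (v w : Fin 3 → ℝ) : ℝ := v 0 * w 0 + v 1 * w 1 + v 2 * w 2

/-- Cross product on ℝ³. -/
def cross3 (v w : Fin 3 → ℝ) : Fin 3 → ℝ :=
  ![v 1 * w 2 - v 2 * w 1, v 2 * w 0 - v 0 * w 2, v 0 * w 1 - v 1 * w 0]

/-- Euclidean norm on ℝ³. -/
def norm3 (v : Fin 3 → ℝ) : ℝ := Real.sqrt (dot3 v v)

/-- `T = Σ_{i,j∈{1,2}} (1 − Ri·Rj)(Rbi·Rbj)`. -/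
def Tq (R1 R2 Rb1 Rb2 : Fin 3 → ℝ) : ℝ :=
  (1 - dot3 R1 R1) * dot3 Rb1 Rb1 + (1 - dot3 R1 R2) * dot3 Rb1 Rb2
    + (1 - dot3 R2 R1) * dot3 Rb2 Rb1 + (1 - dot3 R2 R2) * dot3 Rb2 Rb2

/-- `S = √(T² + 4·Rbx²·(Rm² − Rx²))`. -/
def Sq (R1 R2 Rb1 Rb2 : Fin 3 → ℝ) : ℝ :=
  Real.sqrt ((Tq R1 R2 Rb1 Rb2) ^ 2
    + 4 * (norm3 (cross3 Rb1 Rb2)) ^ 2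
      * ((norm3 (R1 - R2)) ^ 2 - (norm3 (cross3 R1 R2)) ^ 2))

/-- Indicator function `Ω = S + T − 2·Rbx·Rx`. -/
def Omega (R1 R2 Rb1 Rb2 : Fin 3 → ℝ) : ℝ :=
  Sq R1 R2 Rb1 Rb2 + Tq R1 R2 Rb1 Rb2
    - 2 * norm3 (cross3 Rb1 Rb2) * norm3 (cross3 R1 R2)

/-- `Ξ = (R1·(R1−R2))(Rb1·(Rb1+Rb2)) + (R2·(R1−R2))(Rb2·(Rb1+Rb2))`. -/
def Xi (R1 R2 Rb1 Rb2 : Fin 3 → ℝ) : ℝ :=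
  dot3 R1 (R1 - R2) * dot3 Rb1 (Rb1 + Rb2) + dot3 R2 (R1 - R2) * dot3 Rb2 (Rb1 + Rb2)

/-- `ξ = Rx·Rbp² + Rbx·Rm²`. -/
def xiq (R1 R2 Rb1 Rb2 : Fin 3 → ℝ) : ℝ :=
  norm3 (cross3 R1 R2) * (norm3 (Rb1 + Rb2)) ^ 2
    + norm3 (cross3 Rb1 Rb2) * (norm3 (R1 - R2)) ^ 2

/-- `Γ_b² = Rbp² − T + 2·Rx·Rbx`. -/
def Gb2 (R1 R2 Rb1 Rb2 : Fin 3 → ℝ) : ℝ :=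
  (norm3 (Rb1 + Rb2)) ^ 2 - Tq R1 R2 Rb1 Rb2
    + 2 * norm3 (cross3 R1 R2) * norm3 (cross3 Rb1 Rb2)

lemma dot3_self_nonneg (v : Fin 3 → ℝ) : 0 ≤ dot3 v v := by
  unfold dot3
  nlinarith [sq_nonneg (v 0), sq_nonneg (v 1), sq_nonneg (v 2)]

lemma norm3_sq (v : Fin 3 → ℝ) : norm3 v ^ 2 = dot3 v v :=
  Real.sq_sqrt (dot3_self_nonneg v)

/-- Lagrange's identity for `v` and `v - w`, using `v × (v - w) = -(v × w)`. -/
lemma dot3_cross3_self_add_sq (v w : Fin 3 → ℝ) :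
    dot3 (cross3 v w) (cross3 v w) + dot3 v (v - w) ^ 2 =
      dot3 v v * dot3 (v - w) (v - w) := by
  simp only [dot3, cross3, Pi.sub_apply, Matrix.cons_val]
  ring

lemma norm3_cross3_sq_le {v : Fin 3 → ℝ} (hv : norm3 v ≤ 1) (w : Fin 3 → ℝ) :
    norm3 (cross3 v w) ^ 2 ≤ norm3 (v - w) ^ 2 := by
  have hle : dot3 v v ≤ 1 := by
    rw [← norm3_sq]
    exact pow_le_one₀ (Real.sqrt_nonneg _) hv
  rw [norm3_sq, norm3_sq]
  nlinarith [dot3_cross3_self_add_sq v w, sq_nonneg (dot3 v (v - w)),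
    mul_le_mul_of_nonneg_right hle (dot3_self_nonneg (v - w))]

/-- for `R1 ≠ R2`, `‖R1‖ ≤ 1`, `‖R2‖ ≤ 1`, anti-parallel targets
(`Rb1·Rb2 = −‖Rb1‖·‖Rb2‖`) and `T ≤ 0`, one has
`Rx²·(‖Rb1‖ − ‖Rb2‖)² ≤ Rm²·((‖Rb1‖ − ‖Rb2‖)² − T)`. -/
theorem stmt_11 (R1 R2 Rb1 Rb2 : Fin 3 → ℝ) (hne : R1 ≠ R2)
    (h1 : norm3 R1 ≤ 1) (h2 : norm3 R2 ≤ 1)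
    (hanti : dot3 Rb1 Rb2 = -(norm3 Rb1 * norm3 Rb2))
    (hT : Tq R1 R2 Rb1 Rb2 ≤ 0) :
    (norm3 (cross3 R1 R2)) ^ 2 * (norm3 Rb1 - norm3 Rb2) ^ 2 ≤
      (norm3 (R1 - R2)) ^ 2 * ((norm3 Rb1 - norm3 Rb2) ^ 2 - Tq R1 R2 Rb1 Rb2) := by
  exact mul_le_mul (norm3_cross3_sq_le h1 R2) (by linarith) (sq_nonneg _) (sq_nonneg _)
end
end

section
/- Assume R1 ≠ R2, ‖R1‖ ≤ 1, ‖R2‖ ≤ 1, Rb1 ≠ 0, and Rb2 = c·Rb1 for some real c > 0 (parallel nonzero target Bloch vectors). Then T > 0. -/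
noncomputable section

open Real

theorem dot3_self_pos {v : Fin 3 → ℝ} (hv : v ≠ 0) : 0 < dot3 v v := by
  obtain ⟨i, hi⟩ := Function.ne_iff.mp hv
  have h : 0 < v i * v i := mul_self_pos.mpr hi
  unfold dot3
  fin_cases i <;> simp only [Fin.mk_zero, Fin.mk_one, Fin.reduceFinMk] at h <;>
    nlinarith [mul_self_nonneg (v 0), mul_self_nonneg (v 1), mul_self_nonneg (v 2)]

theorem dot3_self_le_one {v : Fin 3 → ℝ} (hv : norm3 v ≤ 1) : dot3 v v ≤ 1 := by
  simpa using (Real.sqrt_le_iff.mp hv).2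

theorem dot3_sub_self (v w : Fin 3 → ℝ) :
    dot3 (v - w) (v - w) = dot3 v v - 2 * dot3 v w + dot3 w w := by
  simp only [dot3, Pi.sub_apply]
  ring

theorem Tq_smul_right (R1 R2 b : Fin 3 → ℝ) (c : ℝ) :
    Tq R1 R2 b (c • b) =
      dot3 b b * ((1 - dot3 R1 R1) + 2 * c * (1 - dot3 R1 R2) + c ^ 2 * (1 - dot3 R2 R2)) := by
  simp only [Tq, dot3, Pi.smul_apply, smul_eq_mul]
  ring

/-- for `R1 ≠ R2`, `‖R1‖ ≤ 1`, `‖R2‖ ≤ 1` and parallel nonzero targets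
`Rb2 = c·Rb1` with `c > 0`, `Rb1 ≠ 0`, one has `T > 0`. -/
theorem stmt_12 (R1 R2 Rb1 : Fin 3 → ℝ) (c : ℝ) (hc : 0 < c)
    (hne : R1 ≠ R2) (h1 : norm3 R1 ≤ 1) (h2 : norm3 R2 ≤ 1)
    (hb : Rb1 ≠ 0) :
    0 < Tq R1 R2 Rb1 (c • Rb1) := by
  have hR1 := dot3_self_le_one h1
  have hR2 := dot3_self_le_one h2
  have hsub := dot3_self_pos (sub_ne_zero.mpr hne)
  rw [dot3_sub_self] at hsub
  have h12 : 0 < 1 - dot3 R1 R2 := by linarith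
  have hcross : 0 < 2 * c * (1 - dot3 R1 R2) := by positivity
  have hsq : 0 ≤ c ^ 2 * (1 - dot3 R2 R2) := mul_nonneg (sq_nonneg c) (by linarith)
  rw [Tq_smul_right]
  exact mul_pos (dot3_self_pos hb) (by linarith)
end
end
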